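/- arXiv:1506.04234 — 6 statements merged into one kernel-verified Lean document; each statement's English description precedes it below -/
import Mathlib

section
/- Let T be the N×N Hermitian Toeplitz matrix determined by t₀ ∈ ℝ and t₁,…,t_{N−1} ∈ ℂ, let c = (t₀, t₁, …, t_{N−1}, 0, t_{N−1}*, …, t₁*)ᵀ ∈ ℂ^{2N}, and let μ = F·c where F is the 2N×2N DFT matrix. Then every entry of μ is real, and the largest eigenvalue of T satisfies λ_max(T) ≤ (1/2)·( max_{0≤i≤N−1} Re(μ_{2i}) + max_{0≤i≤N−1} Re(μ_{2i+1}) ), i.e., one half of the sum of the maximum over the even-indexed entries of μ and the maximum over the odd-indexed entries of μ. -/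
open Matrix

lemma aux_geom (M : ℕ) (z : ℂ) (h1 : z ^ M = 1) :
    ∑ k ∈ Finset.range M, z ^ k = if z = 1 then (M : ℂ) else 0 := by
  split_ifs with h
  · simp [h]
  · have := geom_sum_mul z M
    rw [h1, sub_self] at this
    rcases mul_eq_zero.mp this with h2 | h2
    · exact h2
    · exact absurd (sub_eq_zero.mp h2) h

lemma aux_orth (M : ℕ) (ζ : ℂ) (hζ : IsPrimitiveRoot ζ M) (a : ℤ) :
    ∑ k ∈ Finset.range M, ζ ^ ((k : ℤ) * a) = if (M : ℤ) ∣ a then (M : ℂ) else 0 := by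
  have h1 : (ζ ^ a) ^ M = 1 := by
    rw [← zpow_natCast, ← _root_.zpow_mul, mul_comm, _root_.zpow_mul, zpow_natCast, hζ.pow_eq_one, _root_.one_zpow]
  have := aux_geom M (ζ ^ a) h1
  simp only [hζ.zpow_eq_one_iff_dvd] at this
  rw [← this]
  refine Finset.sum_congr rfl fun k _ => ?_
  rw [mul_comm, _root_.zpow_mul, zpow_natCast]

lemma aux_split (N : ℕ) (f : ℕ → ℂ) : ∑ k ∈ Finset.range (2 * N), f k =
    ∑ i ∈ Finset.range N, f (2 * i) + ∑ i ∈ Finset.range N, f (2 * i + 1) := by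
  induction N with
  | zero => simp
  | succ n ih =>
    rw [show 2 * (n + 1) = 2 * n + 1 + 1 by ring, Finset.sum_range_succ, Finset.sum_range_succ, ih,
      Finset.sum_range_succ, Finset.sum_range_succ]
    ring

/-- zero-padded DFT -/
noncomputable def auxV (N : ℕ) (ζ : ℂ) (v : Fin N → ℂ) (k : ℕ) : ℂ :=
  ∑ n : Fin N, v n * ζ ^ ((k : ℤ) * (n : ℤ))

lemma aux_normSq (N : ℕ) (ζ : ℂ) (hs : star ζ = ζ⁻¹) (h0 : ζ ≠ 0) (v : Fin N → ℂ) (k : ℕ) :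
    ((Complex.normSq (auxV N ζ v k) : ℝ) : ℂ) =
      ∑ m : Fin N, ∑ n : Fin N, star (v m) * v n * ζ ^ ((k : ℤ) * ((n : ℤ) - (m : ℤ))) := by
  rw [Complex.normSq_eq_conj_mul_self]
  change star _ * _ = _
  unfold auxV
  rw [star_sum, Finset.sum_mul_sum]
  refine Finset.sum_congr rfl fun m _ => Finset.sum_congr rfl fun n _ => ?_
  rw [star_mul', star_zpow₀, hs, mul_sub, zpow_sub₀ h0, _root_.inv_zpow]
  ring

lemma aux_parseval (N : ℕ) (hN : 0 < N) (ζ : ℂ) (hs : star ζ = ζ⁻¹) (h0 : ζ ≠ 0)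
    (hζ : IsPrimitiveRoot ζ (2 * N)) (v : Fin N → ℂ) (s : ℕ) :
    ∑ i ∈ Finset.range N, Complex.normSq (auxV N ζ v (2 * i + s)) =
      N * ∑ n, Complex.normSq (v n) := by
  have hζ2 : IsPrimitiveRoot (ζ ^ 2) N := hζ.pow (by omega) rfl
  apply Complex.ofReal_injective
  push_cast
  simp_rw [aux_normSq N ζ hs h0]
  rw [Finset.sum_comm, Finset.mul_sum]
  refine Finset.sum_congr rfl fun m _ => ?_
  rw [Finset.sum_comm, Finset.sum_eq_single m]
  · simp [Complex.normSq_eq_conj_mul_self]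
  · intro n _ hnm
    have key : ∀ i : ℕ, star (v m) * v n * ζ ^ (((2 * i + s : ℕ) : ℤ) * ((n : ℤ) - (m : ℤ))) =
        (star (v m) * v n * ζ ^ ((s : ℤ) * ((n : ℤ) - (m : ℤ)))) *
          (ζ ^ 2) ^ ((i : ℤ) * ((n : ℤ) - (m : ℤ))) := by
      intro i
      rw [← zpow_natCast ζ 2, ← _root_.zpow_mul, mul_assoc _ (ζ ^ _) (ζ ^ _), ← zpow_add₀ h0]
      congr 2
      push_cast
      ring
    simp_rw [key]
    rw [← Finset.mul_sum, aux_orth N _ hζ2, if_neg, mul_zero]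
    intro hd
    have h1 := Int.eq_zero_of_abs_lt_dvd hd (by rw [abs_lt]; constructor <;> omega)
    exact hnm (Fin.ext (by omega))
  · simp

lemma aux_root (N : ℕ) (hN : 0 < N) : ∃ ζ : ℂ, IsPrimitiveRoot ζ (2 * N) ∧ star ζ = ζ⁻¹ ∧
    ζ ≠ 0 ∧ ∀ m n : ℕ, Complex.exp (((-(2 * Real.pi * (m : ℝ) * (n : ℝ) / (2 * N)) : ℝ) : ℂ)
      * Complex.I) = ζ ^ ((m : ℤ) * (n : ℤ)) := by
  have hN' : (N : ℂ) ≠ 0 := by exact_mod_cast hN.ne'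
  refine ⟨(Complex.exp (2 * Real.pi * Complex.I / ((2 * N : ℕ) : ℂ)))⁻¹,
    (Complex.isPrimitiveRoot_exp (2 * N) (by omega)).inv, ?_,
    inv_ne_zero (Complex.exp_ne_zero _), ?_⟩
  · rw [← Complex.exp_neg]
    change (starRingEnd ℂ) _ = _
    rw [← Complex.exp_conj, ← Complex.exp_neg]
    congr 1
    have h2 : (starRingEnd ℂ) 2 = 2 := Complex.conj_ofNat 2
    simp [h2]
    ring
  · intro m n
    rw [← Complex.exp_neg, ← Complex.exp_int_mul]
    congr 1
    push_cast
    field_simp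

/-- the inverse DFT recovers the Toeplitz entries -/
lemma aux_inv (N : ℕ) (ζ : ℂ) (h0 : ζ ≠ 0) (hζ : IsPrimitiveRoot ζ (2 * N))
    (c : Fin (2 * N) → ℂ) (a : ℤ) (j0 : Fin (2 * N)) (hj : ((2 * N : ℕ) : ℤ) ∣ (j0 : ℤ) - a) :
    ∑ k ∈ Finset.range (2 * N), (∑ j : Fin (2 * N), ζ ^ ((k : ℤ) * (j : ℤ)) * c j) *
      ζ ^ ((k : ℤ) * (-a)) = (2 * N : ℕ) * c j0 := by
  simp_rw [Finset.sum_mul]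
  rw [Finset.sum_comm]
  have key : ∀ (j : Fin (2 * N)) (k : ℕ), ζ ^ ((k : ℤ) * (j : ℤ)) * c j * ζ ^ ((k : ℤ) * (-a)) =
      c j * ζ ^ ((k : ℤ) * ((j : ℤ) - a)) := by
    intro j k
    rw [sub_eq_add_neg, mul_add, zpow_add₀ h0]
    ring
  simp_rw [key, ← Finset.mul_sum, aux_orth _ _ hζ]
  rw [Finset.sum_eq_single j0]
  · rw [if_pos hj, mul_comm]
  · intro j _ hjj
    rw [if_neg, mul_zero]
    intro hd
    have h2 := dvd_sub hd hj
    have h1 := Int.eq_zero_of_abs_lt_dvd h2 (by rw [abs_lt]; constructor <;> omega)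
    exact hjj (Fin.ext (by omega))
  · simp

lemma aux_real (N : ℕ) (hN : 0 < N) (t : ℕ → ℂ) (ht0 : (t 0).im = 0)
    (ζ : ℂ) (hs : star ζ = ζ⁻¹) (h0 : ζ ≠ 0) (hζ : IsPrimitiveRoot ζ (2 * N))
    (c : Fin (2 * N) → ℂ)
    (hc : ∀ i : Fin (2 * N), c i =
      if (i : ℕ) < N then t i.1 else if (i : ℕ) = N then 0 else star (t (2 * N - i.1)))
    (k : ℕ) : (∑ j : Fin (2 * N), ζ ^ ((k : ℤ) * (j : ℤ)) * c j).im = 0 := by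
  have : NeZero (2 * N) := ⟨by omega⟩
  rw [← Complex.conj_eq_iff_im]
  change star _ = _
  rw [star_sum, ← Equiv.sum_comp (Equiv.neg (Fin (2 * N)))]
  refine Finset.sum_congr rfl fun j _ => ?_
  have ht0' : star (t 0) = t 0 := Complex.conj_eq_iff_im.mpr ht0
  have hj := j.isLt
  have hv : ((-j : Fin (2 * N)) : ℕ) = (2 * N - j) % (2 * N) := Fin.val_neg' j
  simp only [Equiv.neg_apply]
  by_cases hj0 : (j : ℕ) = 0
  · have hv' : ((-j : Fin (2 * N)) : ℕ) = 0 := by rw [hv, hj0]; simp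
    rw [hc, hc, hv', hj0]
    simp [hN]
    exact ht0'
  · have hv' : ((-j : Fin (2 * N)) : ℕ) = 2 * N - j := by
      rw [hv, Nat.mod_eq_of_lt (by omega)]
    have hcc : star (c (-j)) = c j := by
      rw [hc, hc, hv']
      rcases lt_trichotomy (j : ℕ) N with h | h | h
      · rw [if_neg (by omega), if_neg (by omega), if_pos h, star_star]
        congr 1; omega
      · rw [if_neg (by omega), if_pos (by omega), if_neg (by omega), if_pos h, star_zero]
      · rw [if_pos (by omega), if_neg (by omega), if_neg (by omega)]
    rw [star_mul', hcc, star_zpow₀, hs, hv', _root_.inv_zpow', Nat.cast_sub hj.le]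
    congr 1
    rw [show -((k : ℤ) * (((2 * N : ℕ) : ℤ) - (j : ℤ))) =
      (k : ℤ) * (j : ℤ) + ((2 * N : ℕ) : ℤ) * (-k) by ring, zpow_add₀ h0, _root_.zpow_mul ζ _ (-(k : ℤ)),
      zpow_natCast, hζ.pow_eq_one, _root_.one_zpow, mul_one]

/-- Lemma 3 (upper bound): for a Hermitian Toeplitz matrix `T`, the entries of `μ = F c`
are real and every eigenvalue of `T` is at most
`(1/2)(max over even-indexed entries of μ + max over odd-indexed entries of μ)`. -/
theorem stmt3 (N : ℕ) (hN : 0 < N) (t : ℕ → ℂ) (ht0 : (t 0).im = 0)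
    (T : Matrix (Fin N) (Fin N) ℂ)
    (hT : ∀ m n : Fin N, T m n =
      if (n : ℕ) ≤ (m : ℕ) then t (m.1 - n.1) else star (t (n.1 - m.1)))
    (hHerm : T.IsHermitian)
    (c : Fin (2 * N) → ℂ)
    (hc : ∀ i : Fin (2 * N), c i =
      if (i : ℕ) < N then t i.1 else if (i : ℕ) = N then 0 else star (t (2 * N - i.1)))
    (F : Matrix (Fin (2 * N)) (Fin (2 * N)) ℂ)
    (hF : ∀ m n : Fin (2 * N), F m n =
      Complex.exp (((-(2 * Real.pi * (m.1 : ℝ) * (n.1 : ℝ) / (2 * N)) : ℝ) : ℂ) * Complex.I))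
    (μ : Fin (2 * N) → ℂ) (hμ : μ = F *ᵥ c) :
    (∀ i, (μ i).im = 0) ∧
    ∀ j : Fin N, hHerm.eigenvalues j ≤
      (1 / 2) * ((⨆ i : Fin N, (μ ⟨2 * i.1, by have := i.isLt; omega⟩).re) +
        (⨆ i : Fin N, (μ ⟨2 * i.1 + 1, by have := i.isLt; omega⟩).re)) := by
  obtain ⟨ζ, hζ, hs, h0, hexp⟩ := aux_root N hN
  have hμk : ∀ k : Fin (2 * N), μ k = ∑ j : Fin (2 * N), ζ ^ (((k : ℕ) : ℤ) * (j : ℤ)) * c j := by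
    intro k
    rw [hμ]
    simp only [mulVec, dotProduct, hF, hexp]
  have hreal : ∀ k : ℕ, (∑ j : Fin (2 * N), ζ ^ ((k : ℤ) * (j : ℤ)) * c j).im = 0 :=
    aux_real N hN t ht0 ζ hs h0 hζ c hc
  refine ⟨fun i => by rw [hμk]; exact hreal i, fun j => ?_⟩
  obtain ⟨w, hw⟩ : ∃ w : ℕ → ℂ, ∀ k, w k = ∑ j : Fin (2 * N), ζ ^ ((k : ℤ) * (j : ℤ)) * c j :=
    ⟨_, fun _ => rfl⟩
  have hwr : ∀ k, (((w k).re : ℝ) : ℂ) = w k := fun k => by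
    apply Complex.ext
    · simp
    · rw [hw, hreal]; simp
  have hTw : ∀ m n : Fin N, ∑ k ∈ Finset.range (2 * N), w k * ζ ^ ((k : ℤ) * ((n : ℤ) - (m : ℤ))) =
      (2 * N : ℕ) * T m n := by
    intro m n
    have hm := m.isLt
    have hn := n.isLt
    simp_rw [hw]
    by_cases h : (n : ℕ) ≤ m
    · have := aux_inv N ζ h0 hζ c ((m : ℤ) - n) ⟨m - n, by omega⟩
        ⟨0, by push_cast [Nat.cast_sub h]; ring⟩
      rw [neg_sub] at this
      rw [this, hc, hT, if_pos h, if_pos (by simp only; omega)]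
    · have := aux_inv N ζ h0 hζ c ((m : ℤ) - n) ⟨2 * N - (n - m), by omega⟩
        ⟨1, by simp only; omega⟩
      rw [neg_sub] at this
      rw [this, hc, hT, if_neg h, if_neg (by simp only; omega), if_neg (by simp only; omega)]
      congr 3
      simp only; omega
  obtain ⟨v, hv⟩ : ∃ v : Fin N → ℂ, v = ⇑(hHerm.eigenvectorBasis j) := ⟨_, rfl⟩
  have hnorm : ∑ n, Complex.normSq (v n) = 1 := by
    have h1 := hHerm.eigenvectorBasis.orthonormal.1 j
    have h2 := EuclideanSpace.norm_sq_eq (hHerm.eigenvectorBasis j)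
    rw [h1] at h2
    rw [hv]
    simp only [Complex.normSq_eq_norm_sq]
    rw [← h2]; norm_num
  have hquad : ((2 * N : ℕ) : ℂ) * (star v ⬝ᵥ (T *ᵥ v)) =
      ∑ k ∈ Finset.range (2 * N), w k * (Complex.normSq (auxV N ζ v k) : ℝ) := by
    simp_rw [aux_normSq N ζ hs h0, dotProduct, mulVec, dotProduct, Finset.mul_sum]
    symm
    rw [Finset.sum_comm]
    refine Finset.sum_congr rfl fun m _ => ?_
    rw [Finset.sum_comm]
    refine Finset.sum_congr rfl fun n _ => ?_
    have e1 : ((2 * N : ℕ) : ℂ) * (star v m * (T m n * v n)) =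
      (star (v m) * v n) * (((2 * N : ℕ) : ℂ) * T m n) := by
      simp only [Pi.star_apply]; ring
    rw [e1, ← hTw, Finset.mul_sum]
    refine Finset.sum_congr rfl fun k _ => ?_
    ring
  have heig : hHerm.eigenvalues j = (star v ⬝ᵥ (T *ᵥ v)).re := by
    rw [hHerm.eigenvalues_eq j, hv]; rfl
  have hsum : (2 * N : ℝ) * hHerm.eigenvalues j =
      ∑ i ∈ Finset.range N, (w (2 * i)).re * Complex.normSq (auxV N ζ v (2 * i)) +
      ∑ i ∈ Finset.range N, (w (2 * i + 1)).re * Complex.normSq (auxV N ζ v (2 * i + 1)) := by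
    rw [aux_split] at hquad
    have h3 := congrArg Complex.re hquad
    rw [heig]
    simpa [Complex.re_ofReal_mul, Complex.re_mul_ofReal] using h3
  set A := ⨆ i : Fin N, (μ ⟨2 * i.1, by have := i.isLt; omega⟩).re with hA
  set B := ⨆ i : Fin N, (μ ⟨2 * i.1 + 1, by have := i.isLt; omega⟩).re with hB
  have hwA : ∀ i < N, (w (2 * i)).re ≤ A := by
    intro i hi
    have := le_ciSup (f := fun i : Fin N => (μ ⟨2 * i.1, by have := i.isLt; omega⟩).re)
      (Set.finite_range _).bddAbove ⟨i, hi⟩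
    refine le_trans (le_of_eq ?_) this
    simp only [hμk, hw]
  have hwB : ∀ i < N, (w (2 * i + 1)).re ≤ B := by
    intro i hi
    have := le_ciSup (f := fun i : Fin N => (μ ⟨2 * i.1 + 1, by have := i.isLt; omega⟩).re)
      (Set.finite_range _).bddAbove ⟨i, hi⟩
    refine le_trans (le_of_eq ?_) this
    simp only [hμk, hw]
  have hPA := aux_parseval N hN ζ hs h0 hζ v 0
  have hPB := aux_parseval N hN ζ hs h0 hζ v 1
  rw [hnorm] at hPA hPB
  have b1 : ∑ i ∈ Finset.range N, (w (2 * i)).re * Complex.normSq (auxV N ζ v (2 * i)) ≤ A * N := by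
    rw [← mul_one (N : ℝ), ← hPA, Finset.mul_sum]
    exact Finset.sum_le_sum fun i hi => mul_le_mul_of_nonneg_right
      (hwA i (Finset.mem_range.mp hi)) (Complex.normSq_nonneg _)
  have b2 : ∑ i ∈ Finset.range N, (w (2 * i + 1)).re * Complex.normSq (auxV N ζ v (2 * i + 1)) ≤
      B * N := by
    rw [← mul_one (N : ℝ), ← hPB, Finset.mul_sum]
    exact Finset.sum_le_sum fun i hi => mul_le_mul_of_nonneg_right
      (hwB i (Finset.mem_range.mp hi)) (Complex.normSq_nonneg _)
  have hNpos : (0 : ℝ) < N := by exact_mod_cast hN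
  refine le_of_mul_le_mul_left ?_ (show (0 : ℝ) < 2 * N by linarith)
  linarith
end

section
/- Let p ≥ 2 be a real number, t > 0, and x₀ ∈ [0, t). Define a = ( t^p − x₀^p − p·x₀^{p−1}·(t − x₀) ) / (t − x₀)². Then for every x ∈ [0, t], x^p ≤ a·x² + ( p·x₀^{p−1} − 2·a·x₀ )·x + a·x₀² − (p−1)·x₀^p, and equality holds at x = x₀. In other words, the function f(x) = x^p is majorized at x₀ over the interval [0, t] by this quadratic function. -/
/-- Lemma 8: for `p ≥ 2`, `x₀ ∈ [0, t)`, the quadratic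
`a x² + (p x₀^{p-1} - 2 a x₀) x + a x₀² - (p-1) x₀^p` with
`a = (t^p - x₀^p - p x₀^{p-1}(t - x₀)) / (t - x₀)²` majorizes `x^p` at `x₀` over `[0, t]`. -/
theorem stmt14 (p t x₀ : ℝ) (hp : 2 ≤ p) (ht : 0 < t) (hx₀ : x₀ ∈ Set.Ico 0 t)
    (a : ℝ) (ha : a = (t ^ p - x₀ ^ p - p * x₀ ^ (p - 1) * (t - x₀)) / (t - x₀) ^ 2) :
    (∀ x ∈ Set.Icc (0 : ℝ) t,
      x ^ p ≤ a * x ^ 2 + (p * x₀ ^ (p - 1) - 2 * a * x₀) * x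
        + a * x₀ ^ 2 - (p - 1) * x₀ ^ p) ∧
    x₀ ^ p = a * x₀ ^ 2 + (p * x₀ ^ (p - 1) - 2 * a * x₀) * x₀
      + a * x₀ ^ 2 - (p - 1) * x₀ ^ p := by
  obtain ⟨h0, h1⟩ := hx₀
  have hpow : x₀ ^ p = x₀ ^ (p - 1) * x₀ := by
    rcases h0.eq_or_lt with h | h
    · rw [← h, Real.zero_rpow (by linarith)]; simp
    · rw [Real.rpow_sub_one h.ne']; field_simp
  refine ⟨?_, by rw [hpow]; ring⟩
  have hd : (t - x₀) ≠ 0 := sub_ne_zero.mpr h1.ne'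
  have ha' : a * (t - x₀) ^ 2 = t ^ p - x₀ ^ p - p * x₀ ^ (p - 1) * (t - x₀) := by
    rw [ha]; field_simp
  set g : ℝ → ℝ := fun x => a * (x - x₀) ^ 2 + p * x₀ ^ (p - 1) * (x - x₀) + x₀ ^ p - x ^ p with hg
  set h : ℝ → ℝ := fun x => 2 * a * (x - x₀) + p * x₀ ^ (p - 1) - p * x ^ (p - 1) with hh
  have hder : ∀ x, HasDerivAt g (h x) x := by
    intro x
    have e1 : HasDerivAt (fun x : ℝ => x ^ p) (p * x ^ (p - 1)) x :=
      Real.hasDerivAt_rpow_const (Or.inr (by linarith))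
    have e2 : HasDerivAt (fun x : ℝ => x - x₀) 1 x := (hasDerivAt_id x).sub_const x₀
    have := ((((e2.pow 2).const_mul a).add (e2.const_mul (p * x₀ ^ (p - 1)))).add_const (x₀ ^ p)).sub e1
    refine HasDerivAt.congr_deriv (f := g) this ?_
    show _ = 2 * a * (x - x₀) + p * x₀ ^ (p - 1) - p * x ^ (p - 1)
    push_cast; ring
  have hcont : Continuous g := continuous_iff_continuousAt.mpr fun x => (hder x).continuousAt
  have hgx : g x₀ = 0 := by simp [hg]
  have hgt : g t = 0 := by simp only [hg]; linarith
  have hhx : h x₀ = 0 := by simp [hh]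
  have hconc : ∀ {x y z : ℝ}, 0 ≤ x → x < y → y < z →
      (h z - h y) * (y - x) ≤ (h y - h x) * (z - y) := by
    intro x y z hx hxy hyz
    have := (convexOn_rpow (p := p - 1) (by linarith)).slope_mono_adjacent
      (x := x) (y := y) (z := z) hx (by simp; linarith) hxy hyz
    rw [div_le_div_iff₀ (by linarith) (by linarith)] at this
    have := mul_le_mul_of_nonneg_left this (show 0 ≤ p by linarith)
    simp only [hh]
    linarith
  obtain ⟨c, ⟨hc0, hc1⟩, hc⟩ := exists_hasDerivAt_eq_zero h1 hcont.continuousOn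
    (hgx.trans hgt.symm) (fun x _ => hder x)
  have s1 : AntitoneOn g (Set.Icc 0 x₀) := by
    apply antitoneOn_of_deriv_nonpos (convex_Icc _ _) hcont.continuousOn
      (fun x _ => (hder x).differentiableAt.differentiableWithinAt)
    intro x hx
    rw [interior_Icc] at hx
    rw [(hder x).deriv]
    have := hconc hx.1.le hx.2 hc0
    rw [hc, hhx] at this
    have : 0 < c - x₀ := by linarith
    nlinarith
  have s2 : MonotoneOn g (Set.Icc x₀ c) := by
    apply monotoneOn_of_deriv_nonneg (convex_Icc _ _) hcont.continuousOn
      (fun x _ => (hder x).differentiableAt.differentiableWithinAt)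
    intro x hx
    rw [interior_Icc] at hx
    rw [(hder x).deriv]
    have := hconc h0 hx.1 hx.2
    rw [hc, hhx] at this
    have : 0 < c - x₀ := by linarith
    nlinarith
  have s3 : AntitoneOn g (Set.Icc c t) := by
    apply antitoneOn_of_deriv_nonpos (convex_Icc _ _) hcont.continuousOn
      (fun x _ => (hder x).differentiableAt.differentiableWithinAt)
    intro x hx
    rw [interior_Icc] at hx
    rw [(hder x).deriv]
    have := hconc h0 hc0 hx.1
    rw [hc, hhx] at this
    have : 0 < c - x₀ := by linarith
    nlinarith
  intro x hx
  have key : 0 ≤ g x := by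
    rcases le_total x x₀ with h2 | h2
    · have := s1 ⟨hx.1, h2⟩ ⟨h0, le_rfl⟩ h2
      linarith
    · rcases le_total x c with h3 | h3
      · have := s2 ⟨le_rfl, hc0.le⟩ ⟨h2, h3⟩ h2
        linarith
      · have := s3 ⟨h3, hx.2⟩ ⟨hc1.le, le_rfl⟩ hx.2
        linarith
  simp only [hg] at key
  rw [hpow] at key ⊢
  linarith
end

section
/- Let t > 0, let f : ℝ → ℝ be differentiable on [0, t] with derivative f′ convex on [0, t], and let x₀ ∈ [0, t). Set A(t) = ( f(t) − f(x₀) − f′(x₀)·(t − x₀) ) / (t − x₀)². Then for every x ∈ [0, t], f(x) − f(x₀) − f′(x₀)·(x − x₀) ≤ A(t)·(x − x₀)²; equivalently, the quantity A(x) = ( f(x) − f(x₀) − f′(x₀)(x − x₀) ) / (x − x₀)² attains its maximum over x ∈ [0,t], x ≠ x₀, at x = t. -/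
/-- If `f` is differentiable on `[0, t]` with convex derivative `f'`, and `x₀ ∈ [0, t)`, then
for all `x ∈ [0, t]`,
`f(x) - f(x₀) - f'(x₀)(x - x₀) ≤ A(t) (x - x₀)²` where
`A(t) = (f(t) - f(x₀) - f'(x₀)(t - x₀)) / (t - x₀)²`; i.e., `A(x)` is maximized at `x = t`. -/
theorem stmt15 (t : ℝ) (ht : 0 < t) (f f' : ℝ → ℝ)
    (hderiv : ∀ x ∈ Set.Icc (0 : ℝ) t, HasDerivWithinAt f (f' x) (Set.Icc (0 : ℝ) t) x)
    (hconv : ConvexOn ℝ (Set.Icc (0 : ℝ) t) f')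
    (x₀ : ℝ) (hx₀ : x₀ ∈ Set.Ico 0 t) :
    ∀ x ∈ Set.Icc (0 : ℝ) t,
      f x - f x₀ - f' x₀ * (x - x₀) ≤
        ((f t - f x₀ - f' x₀ * (t - x₀)) / (t - x₀) ^ 2) * (x - x₀) ^ 2 := by
  obtain ⟨h0, h1⟩ := hx₀
  have hpos : 0 < t - x₀ := by linarith
  generalize hA : (f t - f x₀ - f' x₀ * (t - x₀)) / (t - x₀) ^ 2 = A
  have hA' : f t - f x₀ - f' x₀ * (t - x₀) = A * (t - x₀) ^ 2 := by
    rw [← hA]; field_simp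
  let g : ℝ → ℝ := fun x => f x - f x₀ - f' x₀ * (x - x₀) - A * (x - x₀) ^ 2
  let dg : ℝ → ℝ := fun x => f' x - f' x₀ - 2 * A * (x - x₀)
  have hg : ∀ x ∈ Set.Icc (0 : ℝ) t, HasDerivWithinAt g (dg x) (Set.Icc (0 : ℝ) t) x := by
    intro x hx
    have e : HasDerivAt (fun x : ℝ => x - x₀) 1 x := (hasDerivAt_id x).sub_const x₀
    have e1 := (e.const_mul (f' x₀)).hasDerivWithinAt (s := Set.Icc (0 : ℝ) t)
    have e2 := ((e.pow 2).const_mul A).hasDerivWithinAt (s := Set.Icc (0 : ℝ) t)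
    have := (((hderiv x hx).sub_const (f x₀)).sub e1).sub e2
    refine this.congr_deriv ?_
    simp only [dg]
    push_cast
    ring
  have hgc : ContinuousOn g (Set.Icc 0 t) := fun x hx => (hg x hx).continuousWithinAt
  have g0 : g x₀ = 0 := by simp [g]
  have gt : g t = 0 := by simp only [g]; linarith
  have hdz : dg x₀ = 0 := by simp [dg]
  have key : ∀ a b c : ℝ, 0 ≤ a → a < b → b < c → c ≤ t →
      dg b * (c - a) ≤ dg a * (c - b) + dg c * (b - a) := by
    intro a b c ha hab hbc hc
    have := hconv.slope_mono_adjacent (x := a) (y := b) (z := c)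
      ⟨ha, by linarith⟩ ⟨by linarith, hc⟩ hab hbc
    rw [div_le_div_iff₀ (by linarith) (by linarith)] at this
    simp only [dg]
    nlinarith
  obtain ⟨c, ⟨hc1, hc2⟩, hc⟩ : ∃ c ∈ Set.Ioo x₀ t, dg c = 0 := by
    refine exists_hasDerivAt_eq_zero h1 (hgc.mono (Set.Icc_subset_Icc_left h0))
      (g0.trans gt.symm) ?_
    intro x hx
    exact (hg x ⟨by linarith [hx.1], hx.2.le⟩).hasDerivAt
      (Icc_mem_nhds (by linarith [hx.1]) hx.2)
  have sub : ∀ a b x : ℝ, 0 ≤ a → b ≤ t → x ∈ interior (Set.Icc a b) →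
      HasDerivWithinAt g (dg x) (interior (Set.Icc a b)) x := by
    intro a b x ha hb hx
    have hs : interior (Set.Icc a b) ⊆ Set.Icc 0 t :=
      interior_subset.trans (Set.Icc_subset_Icc ha hb)
    exact (hg x (hs hx)).mono hs
  have up : ∀ a b : ℝ, 0 ≤ a → b ≤ t → (∀ x, a < x → x < b → 0 ≤ dg x) →
      MonotoneOn g (Set.Icc a b) := by
    intro a b ha hb h
    refine monotoneOn_of_hasDerivWithinAt_nonneg (convex_Icc a b)
      (hgc.mono (Set.Icc_subset_Icc ha hb)) (fun x hx => sub a b x ha hb hx) ?_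
    intro x hx
    rw [interior_Icc] at hx
    exact h x hx.1 hx.2
  have down : ∀ a b : ℝ, 0 ≤ a → b ≤ t → (∀ x, a < x → x < b → dg x ≤ 0) →
      AntitoneOn g (Set.Icc a b) := by
    intro a b ha hb h
    refine antitoneOn_of_hasDerivWithinAt_nonpos (convex_Icc a b)
      (hgc.mono (Set.Icc_subset_Icc ha hb)) (fun x hx => sub a b x ha hb hx) ?_
    intro x hx
    rw [interior_Icc] at hx
    exact h x hx.1 hx.2
  intro x ⟨hx0, hxt⟩
  suffices hgx : g x ≤ 0 by
    simp only [g] at hgx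
    linarith
  rcases le_total x x₀ with h | h
  · have := up 0 x₀ le_rfl h1.le (fun y hy1 hy2 => by
      have := key y x₀ c hy1.le hy2 hc1 hc2.le
      rw [hdz, hc] at this
      by_contra! hn
      nlinarith [mul_pos_of_neg_of_neg hn (by linarith : x₀ - c < 0), mul_pos (neg_pos.2 hn) (sub_pos.2 hc1)])
    exact g0 ▸ this ⟨hx0, h⟩ ⟨h0, le_rfl⟩ h
  rcases le_total x c with h' | h'
  · have := down x₀ c h0 hc2.le (fun y hy1 hy2 => by
      have := key x₀ y c h0 hy1 hy2 hc2.le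
      rw [hdz, hc] at this
      by_contra! hn
      nlinarith [mul_pos hn (sub_pos.2 hc1)])
    exact g0 ▸ this ⟨le_rfl, hc1.le⟩ ⟨h, h'⟩ h
  · have := up c t (by linarith) le_rfl (fun y hy1 hy2 => by
      have := key x₀ c y h0 hc1 hy1 hy2.le
      rw [hdz, hc] at this
      by_contra! hn
      nlinarith [mul_pos (neg_pos.2 hn) (sub_pos.2 hc1)])
    exact gt ▸ this ⟨h', hxt⟩ ⟨hc2.le, le_rfl⟩ hxt
end

section
/- Let f : ℝ → ℝ be differentiable on an interval [a, b] with derivative f′ convex on [a, b]. Then for all x₀, x ∈ [a, b] with x₀ ≤ x, f(x) − f(x₀) ≤ (x − x₀)·( f′(x) + f′(x₀) ) / 2. -/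
/-- If `f` is differentiable on `[a, b]` with convex derivative `f'`, then for
`x₀ ≤ x` in `[a, b]`, `f(x) - f(x₀) ≤ (x - x₀)(f'(x) + f'(x₀))/2`. -/
theorem stmt16 (a b : ℝ) (hab : a ≤ b) (f f' : ℝ → ℝ)
    (hderiv : ∀ x ∈ Set.Icc a b, HasDerivWithinAt f (f' x) (Set.Icc a b) x)
    (hconv : ConvexOn ℝ (Set.Icc a b) f') :
    ∀ x₀ ∈ Set.Icc a b, ∀ x ∈ Set.Icc a b, x₀ ≤ x →
      f x - f x₀ ≤ (x - x₀) * (f' x + f' x₀) / 2 := by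
  intro x₀ hx₀ x hx hle
  rcases hle.eq_or_lt with rfl | hlt
  · simp
  have hd : 0 < x - x₀ := sub_pos.mpr hlt
  obtain ⟨m, hm⟩ : ∃ m, m = (f' x - f' x₀) / (x - x₀) := ⟨_, rfl⟩
  have hm' : m * (x - x₀) = f' x - f' x₀ := by rw [hm]; field_simp
  have hsub : Set.Icc x₀ x ⊆ Set.Icc a b := Set.Icc_subset_Icc hx₀.1 hx.2
  obtain ⟨c, hc, hslope⟩ := exists_hasDerivAt_eq_slope
    (fun t => f t - (f' x₀ * t + m / 2 * (t - x₀) ^ 2))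
    (fun t => f' t - (f' x₀ * 1 + m / 2 * (2 * (t - x₀)))) hlt
    (by
      have hf : ContinuousOn f (Set.Icc x₀ x) := fun t ht =>
        ((hderiv t (hsub ht)).continuousWithinAt).mono hsub
      exact hf.sub (by fun_prop))
    (by
      intro t ht
      have h1 : HasDerivAt f (f' t) t :=
        (hderiv t (hsub ⟨ht.1.le, ht.2.le⟩)).hasDerivAt
          (Icc_mem_nhds (hx₀.1.trans_lt ht.1) (ht.2.trans_le hx.2))
      have h2 : HasDerivAt (fun t : ℝ => (t - x₀) ^ 2) (2 * (t - x₀)) t := by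
        have h3 := ((hasDerivAt_id t).sub_const x₀).fun_pow 2
        simpa using h3
      exact h1.sub (((hasDerivAt_id t).const_mul (f' x₀)).add (h2.const_mul (m / 2))))
  have w1 : 0 ≤ (x - c) / (x - x₀) := div_nonneg (by linarith [hc.2]) hd.le
  have w2 : 0 ≤ (c - x₀) / (x - x₀) := div_nonneg (by linarith [hc.1]) hd.le
  have hcv := hconv.2 hx₀ hx w1 w2
    (by field_simp; ring)
  have e1 : ((x - c) / (x - x₀)) • x₀ + ((c - x₀) / (x - x₀)) • x = c := by
    simp only [smul_eq_mul]; field_simp; ring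
  have e2 : ((x - c) / (x - x₀)) • f' x₀ + ((c - x₀) / (x - x₀)) • f' x
      = f' x₀ + m * (c - x₀) := by
    rw [hm]; simp only [smul_eq_mul]; field_simp; ring
  rw [e1, e2] at hcv
  rw [eq_div_iff hd.ne'] at hslope
  have hneg : (f' c - (f' x₀ * 1 + m / 2 * (2 * (c - x₀)))) * (x - x₀) ≤ 0 :=
    mul_nonpos_of_nonpos_of_nonneg (by linarith) hd.le
  have e3 : m / 2 * (x - x₀) ^ 2 = (f' x - f' x₀) * (x - x₀) / 2 := by
    rw [← hm']; ring
  rw [hslope] at hneg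
  simp only [e3, sub_self] at hneg
  linarith
end

section
/- Let p ≥ 2 be a real number, t > 0, and x₀ ∈ [0, t). With a = ( t^p − x₀^p − p·x₀^{p−1}·(t − x₀) ) / (t − x₀)², the coefficient b = p·x₀^{p−1} − 2·a·x₀ satisfies b ≤ 0. -/
/-- The linear coefficient `b = p x₀^{p-1} - 2 a x₀` of the quadratic majorizer of `x^p`
at `x₀` on `[0, t]` is nonpositive. -/
theorem stmt18 (p t x₀ : ℝ) (hp : 2 ≤ p) (ht : 0 < t) (hx₀ : x₀ ∈ Set.Ico 0 t)
    (a : ℝ) (ha : a = (t ^ p - x₀ ^ p - p * x₀ ^ (p - 1) * (t - x₀)) / (t - x₀) ^ 2) :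
    p * x₀ ^ (p - 1) - 2 * a * x₀ ≤ 0 := by
  obtain ⟨h0, hlt⟩ := hx₀
  rcases h0.eq_or_lt with h | hx
  · subst h
    rw [Real.zero_rpow (by linarith)]
    simp
  · have hd : 0 < (t - x₀) ^ 2 := by
      have : 0 < t - x₀ := by linarith
      positivity
    obtain ⟨s, hs⟩ : ∃ s, s = t / x₀ := ⟨_, rfl⟩
    have hs0 : 0 < s := by rw [hs]; positivity
    have hts : t = s * x₀ := by rw [hs]; field_simp
    have hB : 1 + p / 2 * (s ^ 2 - 1) ≤ s ^ p := by
      have := one_add_mul_self_le_rpow_one_add (s := s ^ 2 - 1) (by nlinarith [sq_nonneg s])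
        (p := p / 2) (by linarith)
      have e : (1 + (s ^ 2 - 1)) ^ (p / 2) = s ^ p := by
        rw [add_sub_cancel, ← Real.rpow_natCast, ← Real.rpow_mul hs0.le]
        congr 1
        push_cast
        ring
      rwa [e] at this
    have hxp : x₀ ^ p = x₀ ^ (p - 1) * x₀ := by
      rw [← Real.rpow_add_one hx.ne']; congr 1; ring
    have hy : 0 < x₀ ^ (p - 1) := Real.rpow_pos_of_pos hx _
    have hm : a * (t - x₀) ^ 2 = t ^ p - x₀ ^ p - p * x₀ ^ (p - 1) * (t - x₀) := by
      rw [ha]; field_simp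
    have htp : t ^ p = s ^ p * (x₀ ^ (p - 1) * x₀) := by
      rw [hts, Real.mul_rpow hs0.le hx.le, hxp]
    rw [htp, hxp] at hm
    have hk : 0 ≤ x₀ ^ (p - 1) * x₀ ^ 2 * (s ^ p - (1 + p / 2 * (s ^ 2 - 1))) :=
      mul_nonneg (by positivity) (by linarith)
    have key : (p * x₀ ^ (p - 1) - 2 * a * x₀) * (t - x₀) ^ 2 =
        -2 * (x₀ ^ (p - 1) * x₀ ^ 2 * (s ^ p - (1 + p / 2 * (s ^ 2 - 1)))) := by
      have : (p * x₀ ^ (p - 1) - 2 * a * x₀) * (t - x₀) ^ 2 =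
        p * x₀ ^ (p - 1) * (t - x₀) ^ 2 - 2 * x₀ * (a * (t - x₀) ^ 2) := by ring
      rw [this, hm]
      generalize x₀ ^ (p - 1) = y
      generalize s ^ p = z
      rw [hts]
      ring
    by_contra hc
    push Not at hc
    have := mul_pos hc hd
    linarith
end

section
/- Let C ⊆ ℂᴺ be a nonempty compact set and let u : ℂᴺ × ℂᴺ → ℝ be continuous on C × C, define f(x) = u(x, x), and suppose u(x, y) ≥ f(x) for all x, y ∈ C (so that for each y ∈ C, u(·, y) majorizes f at y over C). Let (x⁽ˡ⁾)_{l≥0} be a sequence in C such that for each l, x⁽ˡ⁺¹⁾ is a global minimizer of u(·, x⁽ˡ⁾) over C, i.e., u(x⁽ˡ⁺¹⁾, x⁽ˡ⁾) ≤ u(x, x⁽ˡ⁾) for all x ∈ C. Then the sequence (f(x⁽ˡ⁾)) is nonincreasing, and every limit point x⁽∞⁾ of (x⁽ˡ⁾) is a global minimizer of u(·, x⁽∞⁾) over C, i.e., u(x⁽∞⁾, x⁽∞⁾) ≤ u(x, x⁽∞⁾) for all x ∈ C. -/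
/-- MM convergence mechanism: if `u(·, y)` majorizes `f = u(·,·)` diagonal over a compact
set `C`, and each iterate globally minimizes `u(·, x⁽ˡ⁾)` over `C`, then the objective
values are nonincreasing and every limit point `x⁽∞⁾` globally minimizes `u(·, x⁽∞⁾)`. -/
theorem stmt19 (N : ℕ) (C : Set (Fin N → ℂ)) (hC : IsCompact C) (hCne : C.Nonempty)
    (u : (Fin N → ℂ) → (Fin N → ℂ) → ℝ)
    (hu : ContinuousOn (fun p : (Fin N → ℂ) × (Fin N → ℂ) => u p.1 p.2) (C ×ˢ C))
    (hmaj : ∀ x ∈ C, ∀ y ∈ C, u x x ≤ u x y)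
    (xs : ℕ → (Fin N → ℂ)) (hmem : ∀ l, xs l ∈ C)
    (hmin : ∀ l, ∀ y ∈ C, u (xs (l + 1)) (xs l) ≤ u y (xs l)) :
    (∀ l, u (xs (l + 1)) (xs (l + 1)) ≤ u (xs l) (xs l)) ∧
    ∀ xinf : Fin N → ℂ,
      (∃ φ : ℕ → ℕ, StrictMono φ ∧
        Filter.Tendsto (xs ∘ φ) Filter.atTop (nhds xinf)) →
      ∀ y ∈ C, u xinf xinf ≤ u y xinf := by
  have hdec : ∀ l, u (xs (l + 1)) (xs (l + 1)) ≤ u (xs l) (xs l) := fun l =>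
    (hmaj _ (hmem _) _ (hmem l)).trans (hmin l _ (hmem l))
  refine ⟨hdec, ?_⟩
  rintro xinf ⟨φ, hφ, hlim⟩ y hy
  have hanti : Antitone (fun l => u (xs l) (xs l)) := antitone_nat_of_succ_le hdec
  have hinf : xinf ∈ C :=
    hC.isClosed.mem_of_tendsto hlim (Filter.Eventually.of_forall fun j => hmem (φ j))
  have key : ∀ a : ℕ → (Fin N → ℂ), (∀ j, a j ∈ C) → ∀ a' ∈ C,
      Filter.Tendsto a Filter.atTop (nhds a') →
      Filter.Tendsto (fun j => u (a j) (xs (φ j))) Filter.atTop (nhds (u a' xinf)) := by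
    intro a ha a' ha' hl
    have h1 := hu (a', xinf) ⟨ha', hinf⟩
    have h2 : Filter.Tendsto (fun j => (a j, xs (φ j))) Filter.atTop
        (nhdsWithin (a', xinf) (C ×ˢ C)) :=
      tendsto_nhdsWithin_iff.2 ⟨hl.prodMk_nhds hlim,
        Filter.Eventually.of_forall fun j => ⟨ha j, hmem (φ j)⟩⟩
    exact h1.tendsto.comp h2
  have hL := (key (fun j => xs (φ j)) (fun j => hmem _) xinf hinf hlim).comp
    (Filter.tendsto_add_atTop_nat 1)
  have hR := key (fun _ => y) (fun _ => hy) y hy tendsto_const_nhds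
  refine le_of_tendsto_of_tendsto' hL hR fun j => ?_
  have h3 : φ j + 1 ≤ φ (j + 1) := hφ (Nat.lt_succ_self j)
  exact (hanti h3).trans ((hmaj _ (hmem _) _ (hmem (φ j))).trans (hmin (φ j) y hy))
end
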